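/- A graph G with a perfect matching can be covered by a collection of independent edges together with a positive number of vertex-disjoint odd cycles if and only if G contains an even subdivision of T as a nice subgraph. -/

import Mathlib

open SimpleGraph

variable {V : Type*}

/-- A graph has a perfect matching. -/
def HasPM (G : SimpleGraph V) : Prop := ∃ M : G.Subgraph, M.IsPerfectMatching

/-- A set of vertices is independent (pairwise nonadjacent). -/
def IsIndep (G : SimpleGraph V) (s : Set V) : Prop := ∀ x ∈ s, ∀ y ∈ s, ¬ G.Adj x y

/-- The independence number. -/
noncomputable def alphaNum (G : SimpleGraph V) : ℕ :=
  sSup {n | ∃ s : Set V, IsIndep G s ∧ s.ncard = n}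

/-- The matching number. -/
noncomputable def matchNum (G : SimpleGraph V) : ℕ :=
  sSup {n | ∃ M : G.Subgraph, M.IsMatching ∧ M.edgeSet.ncard = n}

/-- A graph is König-Egerváry if α + ν = n. -/
def IsKE (G : SimpleGraph V) : Prop := alphaNum G + matchNum G = Nat.card V

/-- `G` is (the whole graph) an even subdivision of `K₄`: four corner vertices and six
internally disjoint odd paths joining each pair of corners, comprising all vertices
and edges of `G`. -/
def IsEvenSubdivK4 (G : SimpleGraph V) : Prop :=
  ∃ (c : Fin 4 → V) (P : ∀ i j : Fin 4, G.Walk (c i) (c j)),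
    Function.Injective c ∧
    (∀ i j : Fin 4, P j i = (P i j).reverse) ∧
    (∀ i j : Fin 4, i ≠ j → (P i j).IsPath ∧ Odd (P i j).length) ∧
    (∀ i j k l : Fin 4, i ≠ j → k ≠ l → ¬(i = k ∧ j = l) → ¬(i = l ∧ j = k) →
      ∀ x : V, x ∈ (P i j).support → x ∈ (P k l).support → x ∈ Set.range c) ∧
    (∀ x : V, ∃ i j : Fin 4, i ≠ j ∧ x ∈ (P i j).support) ∧
    (∀ e : Sym2 V, e ∈ G.edgeSet ↔ ∃ i j : Fin 4, i ≠ j ∧ e ∈ (P i j).edges)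

/-- `G` is (the whole graph) an even subdivision of `T`: two vertex-disjoint odd cycles
joined at blossom tips `v`, `w` by an odd path internally disjoint from the cycles,
comprising all vertices and edges of `G`. -/
def IsEvenSubdivT (G : SimpleGraph V) : Prop :=
  ∃ (v w : V) (C1 : G.Walk v v) (C2 : G.Walk w w) (P : G.Walk v w),
    C1.IsCycle ∧ C2.IsCycle ∧ Odd C1.length ∧ Odd C2.length ∧
    P.IsPath ∧ Odd P.length ∧
    (∀ x : V, x ∈ C1.support → x ∉ C2.support) ∧
    (∀ x : V, x ∈ P.support → x ∈ C1.support → x = v) ∧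
    (∀ x : V, x ∈ P.support → x ∈ C2.support → x = w) ∧
    (∀ x : V, x ∈ C1.support ∨ x ∈ C2.support ∨ x ∈ P.support) ∧
    (∀ e : Sym2 V, e ∈ G.edgeSet ↔ e ∈ C1.edges ∨ e ∈ C2.edges ∨ e ∈ P.edges)

/-- `G` contains a nice even subdivision of `T`: a subgraph `H` which is an even
subdivision of `T` and such that `G - V(H)` has a perfect matching. -/
def HasNiceEvenSubdivT (G : SimpleGraph V) : Prop :=
  ∃ H : G.Subgraph, IsEvenSubdivT H.coe ∧ HasPM (G.induce (H.vertsᶜ))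

/-- `G` has a spanning subgraph whose components are independent edges together with a
positive number of vertex-disjoint odd cycles. -/
def HasOddCycleCover (G : SimpleGraph V) : Prop :=
  ∃ (M : G.Subgraph) (k : ℕ) (u : Fin k → V) (C : ∀ i : Fin k, G.Walk (u i) (u i)),
    0 < k ∧ M.IsMatching ∧
    (∀ i, (C i).IsCycle ∧ Odd (C i).length) ∧
    (∀ i j, i ≠ j → ∀ x : V, x ∈ (C i).support → x ∉ (C j).support) ∧
    (∀ i, ∀ x ∈ (C i).support, x ∉ M.verts) ∧
    (∀ x : V, x ∈ M.verts ∨ ∃ i, x ∈ (C i).support)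

/-- A matchable graph is Egerváry iff it has no such spanning cover. -/
def IsEgervary (G : SimpleGraph V) : Prop := ¬ HasOddCycleCover G

/-- `G` contains two vertex-disjoint odd cycles. -/
def TwoDisjointOddCycles (G : SimpleGraph V) : Prop :=
  ∃ (a b : V) (C1 : G.Walk a a) (C2 : G.Walk b b),
    C1.IsCycle ∧ C2.IsCycle ∧ Odd C1.length ∧ Odd C2.length ∧
    ∀ x : V, x ∈ C1.support → x ∉ C2.support

/-- `G` is α-critical: deleting any edge increases the independence number. -/
def AlphaCritical (G : SimpleGraph V) : Prop :=
  ∀ e ∈ G.edgeSet, alphaNum (G.deleteEdges {e}) = alphaNum G + 1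

/-- The (open) neighborhood of a set of vertices. -/
def setN (G : SimpleGraph V) (I : Set V) : Set V := {x | x ∉ I ∧ ∃ y ∈ I, G.Adj x y}

/-! ### Matchings as functions -/

/-- `f` is an involution on `S` matching each vertex to a neighbour. -/
def MatchOn (G : SimpleGraph V) (S : Set V) (f : V → V) : Prop :=
  ∀ x ∈ S, f x ∈ S ∧ f (f x) = x ∧ G.Adj x (f x)

/-- `S` is perfectly matchable inside `G`. -/
def Mable (G : SimpleGraph V) (S : Set V) : Prop := ∃ f, MatchOn G S f

theorem Mable.union {G : SimpleGraph V} {S T : Set V} (hS : Mable G S) (hT : Mable G T)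
    (hd : ∀ x ∈ S, x ∉ T) : Mable G (S ∪ T) := by
  classical
  obtain ⟨f, hf⟩ := hS
  obtain ⟨g, hg⟩ := hT
  refine ⟨fun x => if x ∈ S then f x else g x, ?_⟩
  intro x hx
  by_cases h : x ∈ S
  · have := hf x h
    simp [h, this]
  · have hxT : x ∈ T := hx.resolve_left h
    obtain ⟨h1, h2, h3⟩ := hg x hxT
    have h4 : g x ∉ S := fun h5 => hd _ h5 h1
    simp [h, h1, h2, h3, h4]

theorem Mable.pair {G : SimpleGraph V} {a b : V} (h : G.Adj a b) : Mable G {a, b} := by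
  classical
  refine ⟨fun x => if x = a then b else a, ?_⟩
  have hne := h.ne
  rintro x (rfl | hx)
  · simp [h, hne.symm]
  · rw [Set.mem_singleton_iff] at hx
    subst hx
    simp [hne.symm, h.symm]

theorem Mable.empty {G : SimpleGraph V} : Mable G ∅ := ⟨id, by intro x hx; exact hx.elim⟩

theorem Mable.of_isMatching {G : SimpleGraph V} {M : G.Subgraph} (h : M.IsMatching) :
    Mable G M.verts := by
  classical
  choose! f hf using fun v (hv : v ∈ M.verts) => h hv
  refine ⟨f, fun x hx => ?_⟩
  have h1 := (hf x hx).1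
  have h2 : f x ∈ M.verts := M.edge_vert h1.symm
  refine ⟨h2, ?_, M.adj_sub h1⟩
  exact ((hf (f x) h2).2 x h1.symm).symm

theorem Mable.exists_isMatching {G : SimpleGraph V} {S : Set V} (h : Mable G S) :
    ∃ M : G.Subgraph, M.IsMatching ∧ M.verts = S := by
  obtain ⟨f, hf⟩ := h
  refine ⟨⟨S, fun x y => x ∈ S ∧ f x = y, ?_, ?_, ?_⟩, ?_, rfl⟩
  · rintro x y ⟨hx, rfl⟩
    exact (hf x hx).2.2
  · rintro x y ⟨hx, rfl⟩
    exact hx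
  · constructor
    rintro x y ⟨hx, rfl⟩
    exact ⟨(hf x hx).1, (hf x hx).2.1⟩
  · intro x hx
    exact ⟨f x, ⟨hx, rfl⟩, fun y hy => hy.2.symm⟩

theorem Mable.hasPM_induce {G : SimpleGraph V} {S : Set V} (h : Mable G S) :
    HasPM (G.induce S) := by
  obtain ⟨f, hf⟩ := h
  refine ⟨⟨Set.univ, fun x y => f x = y, ?_, ?_, ?_⟩, ?_⟩
  · intro x y hxy
    have := (hf x x.2).2.2
    rw [hxy] at this
    simpa using this
  · intros; trivial
  · constructor
    intro x y hxy
    have := (hf x x.2).2.1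
    rw [hxy] at this
    exact this
  · rw [Subgraph.isPerfectMatching_iff]
    intro x
    exact ⟨⟨f x, (hf x x.2).1⟩, rfl, fun y hy => Subtype.ext (Eq.symm (a := f x) hy)⟩

theorem Mable.of_hasPM_induce {G : SimpleGraph V} {S : Set V} (h : HasPM (G.induce S)) :
    Mable G S := by
  classical
  obtain ⟨M, hM⟩ := h
  obtain ⟨f, hf⟩ := Mable.of_isMatching hM.1
  have hv : ∀ x, x ∈ M.verts := hM.2
  refine ⟨fun x => if h : x ∈ S then f ⟨x, h⟩ else x, fun x hx => ?_⟩
  obtain ⟨h1, h2, h3⟩ := hf ⟨x, hx⟩ (hv _)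
  have h4 : G.Adj x (f ⟨x, hx⟩) := by simpa using h3
  simp [hx, h2, h4]

theorem Mable.even_ncard [Finite V] {G : SimpleGraph V} {S : Set V} (h : Mable G S) :
    Even S.ncard := by
  classical
  obtain ⟨M, hM, rfl⟩ := h.exists_isMatching
  have := Fintype.ofFinite M.verts
  have h2 := hM.even_card
  rwa [← Set.ncard_eq_toFinset_card'] at h2

/-- An even path minus its last vertex is matchable. -/
theorem mable_even_path {G : SimpleGraph V} : ∀ (k : ℕ) {u v : V} (p : G.Walk u v),
    p.length = 2 * k → p.IsPath → Mable G ({x | x ∈ p.support} \ {v})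
  | 0, u, v, p, hl, hp => by
    cases p with
    | nil =>
      have : ({x | x ∈ (Walk.nil : G.Walk u u).support} \ {u} : Set V) = ∅ := by
        ext x; simp
      rw [this]; exact Mable.empty
    | cons h p => simp at hl
  | k + 1, u, v, p, hl, hp => by
    match p, hl, hp with
    | .nil, hl, hp => simp at hl
    | .cons h .nil, hl, hp => simp at hl; omega
    | .cons (v := a) h (.cons (v := b) h' p), hl, hp =>
      have hp' : p.IsPath := by simp at hp; exact hp.1.1
      have ih := mable_even_path k p (by simp at hl; omega) hp'
      simp only [Walk.cons_isPath_iff, Walk.support_cons, List.mem_cons, not_or] at hp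
      obtain ⟨⟨_, ha⟩, hne, hu⟩ := hp
      have h2 := (Mable.pair h).union ih (by
        rintro x (rfl | hx) ⟨hx1, _⟩
        · exact hu hx1
        · rw [Set.mem_singleton_iff] at hx
          subst hx; exact ha hx1)
      convert h2 using 1
      have hv := p.end_mem_support
      ext x
      simp only [Walk.support_cons, List.mem_cons, Set.mem_sdiff, Set.mem_ofPred_eq,
        Set.mem_singleton_iff, Set.mem_union, Set.mem_insert_iff]
      grind

theorem mable_odd_cycle {G : SimpleGraph V} {v : V} (C : G.Walk v v) (hC : C.IsCycle)
    (ho : Odd C.length) : Mable G ({x | x ∈ C.support} \ {v}) := by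
  cases C with
  | nil => simp at ho
  | cons h p =>
    rw [Walk.cons_isCycle_iff] at hC
    obtain ⟨k, hk⟩ := ho
    have := mable_even_path k p (by simpa using hk) hC.1
    convert this using 1
    ext x
    simp
    grind

theorem mable_odd_path {G : SimpleGraph V} {v w : V} (P : G.Walk v w) (hP : P.IsPath)
    (ho : Odd P.length) : Mable G ({x | x ∈ P.support} \ {v, w}) := by
  cases P with
  | nil => simp at ho
  | cons h p =>
    rw [Walk.cons_isPath_iff] at hP
    obtain ⟨k, hk⟩ := ho
    have := mable_even_path k p (by simpa using hk) hP.1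
    convert this using 1
    ext x
    simp
    grind

theorem odd_ncard_cycle [Finite V] {G : SimpleGraph V} {v : V} (C : G.Walk v v)
    (hC : C.IsCycle) (ho : Odd C.length) : Odd ({x | x ∈ C.support} : Set V).ncard := by
  have h := (mable_odd_cycle C hC ho).even_ncard
  have h2 := Set.ncard_sdiff_singleton_add_one (s := {x | x ∈ C.support}) (a := v) (by simp)
  rw [← h2]
  exact h.add_one

/-- The key path-finding lemma. -/
theorem exists_alt_path [Finite V] {G : SimpleGraph V} {U S : Set V} (hN : Mable G Set.univ)
    (hM : Mable G Uᶜ) (hSU : S ⊆ U) (hS : Odd S.ncard) :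
    ∃ v ∈ S, ∃ w ∈ U \ S, ∃ P : G.Walk v w, P.IsPath ∧ Odd P.length ∧
      (∀ x ∈ P.support, x ∈ U → x = v ∨ x = w) ∧
      Mable G {x | x ∈ P.support} ∧ Mable G (Uᶜ \ {x | x ∈ P.support}) := by
  classical
  obtain ⟨n, hn⟩ := hN
  obtain ⟨m, hm⟩ := hM
  have hn1 : ∀ x, n (n x) = x := fun x => (hn x trivial).2.1
  have hn2 : ∀ x, G.Adj x (n x) := fun x => (hn x trivial).2.2
  let H : SimpleGraph V :=
    { Adj := fun x y => y = n x ∨ (x ∉ U ∧ y = m x)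
      symm := ⟨by
        rintro x y (rfl | ⟨hx, rfl⟩)
        · left; rw [hn1]
        · right; exact ⟨(hm x hx).1, (hm x hx).2.1.symm⟩⟩
      loopless := ⟨by
        rintro x (h | ⟨hx, h⟩)
        · exact (hn2 x).ne h
        · exact (hm x hx).2.2.ne h⟩ }
  have hHadj : ∀ x y, H.Adj x y ↔ (y = n x ∨ (x ∉ U ∧ y = m x)) := fun _ _ => Iff.rfl
  have hHG : H ≤ G := by
    rintro x y (rfl | ⟨hx, rfl⟩)
    · exact hn2 x
    · exact (hm x hx).2.2
  have hex : ∃ ℓ : ℕ, ∃ v ∈ S, ∃ w ∈ U \ S, ∃ p : H.Walk v w, p.length = ℓ := by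
    by_contra hcon
    let R : Set V := {y | ∃ s ∈ S, H.Reachable s y}
    have hR1 : Mable G R := ⟨n, by
      rintro x ⟨s, hs, hr⟩
      exact ⟨⟨s, hs, hr.trans (Adj.reachable (Or.inl rfl))⟩, hn1 x, hn2 x⟩⟩
    have hR2 : Mable G (R \ U) := ⟨m, by
      rintro x ⟨⟨s, hs, hr⟩, hx⟩
      exact ⟨⟨⟨s, hs, hr.trans (Adj.reachable (Or.inr ⟨hx, rfl⟩))⟩, (hm x hx).1⟩,
        (hm x hx).2.1, (hm x hx).2.2⟩⟩
    have hRS : R ∩ U = S := by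
      ext y
      constructor
      · rintro ⟨⟨s, hs, ⟨p⟩⟩, hy⟩
        by_contra hyS
        exact hcon ⟨_, s, hs, y, ⟨hy, hyS⟩, p, rfl⟩
      · intro hy
        exact ⟨⟨y, hy, Reachable.refl _⟩, hSU hy⟩
    have e1 := hR1.even_ncard
    have e2 := hR2.even_ncard
    have e3 := Set.ncard_inter_add_ncard_sdiff_eq_ncard R U
    rw [hRS] at e3
    rw [← e3] at e1
    have := (Nat.even_add.1 e1).2 e2
    exact (Nat.not_even_iff_odd.2 hS) this
  obtain ⟨v, hv, w, hw, p, hpl⟩ := Nat.find_spec hex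
  have hmin : ∀ v' ∈ S, ∀ w' ∈ U \ S, ∀ q : H.Walk v' w', p.length ≤ q.length := by
    intro v' hv' w' hw' q
    rw [hpl]
    exact Nat.find_min' hex ⟨v', hv', w', hw', q, rfl⟩
  have hpath : p.IsPath := by
    have := p.bypass_eq_self_of_length_le_length_bypass (hmin v hv w hw _)
    rw [← this]; exact p.bypass_isPath
  have hU : ∀ x ∈ p.support, x ∈ U → x = v ∨ x = w := by
    intro x hx hxU
    by_contra! hne
    by_cases hxS : x ∈ S
    · have h1 := hmin x hxS w hw (p.dropUntil x hx)
      have h2 := Walk.length_dropUntil_lt_length hx hne.1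
      omega
    · have h1 := hmin v hv x ⟨hxU, hxS⟩ (p.takeUntil x hx)
      have h2 := Walk.length_takeUntil_lt_length hx hne.2
      omega
  have hvw : v ≠ w := fun h => hw.2 (h ▸ hv)
  have hlen : 0 < p.length := by
    rcases Nat.eq_zero_or_pos p.length with h | h
    · exact (hvw (Walk.eq_of_length_eq_zero h)).elim
    · exact h
  -- closure of the path under the two matchings
  have hint : ∀ x ∈ p.support, x ∉ U → n x ∈ p.support ∧ m x ∈ p.support := by
    intro x hx hxU
    obtain ⟨i, rfl, hi⟩ := Walk.mem_support_iff_exists_getVert.1 hx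
    have hi0 : i ≠ 0 := by
      rintro rfl
      rw [Walk.getVert_zero] at hxU
      exact hxU (hSU hv)
    have hil : i ≠ p.length := by
      rintro rfl
      rw [Walk.getVert_length] at hxU
      exact hxU hw.1
    have a1 : H.Adj (p.getVert i) (p.getVert (i + 1)) := p.adj_getVert_succ (by omega)
    have a2 : H.Adj (p.getVert i) (p.getVert (i - 1)) := by
      have := p.adj_getVert_succ (i := i - 1) (by omega)
      rw [Nat.sub_add_cancel (by omega)] at this
      exact this.symm
    have hne : p.getVert (i + 1) ≠ p.getVert (i - 1) := by
      intro h
      have := hpath.getVert_injOn (by simp; omega) (by simp; omega) h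
      omega
    have b1 := p.getVert_mem_support (i + 1)
    have b2 := p.getVert_mem_support (i - 1)
    rw [hHadj] at a1 a2
    grind
  have hnU : ∀ x ∈ p.support, x ∈ U → n x ∈ p.support := by
    intro x hx hxU
    rcases hU x hx hxU with h | h
    · have a1 : H.Adj (p.getVert 0) (p.getVert 1) := p.adj_getVert_succ (i := 0) hlen
      rw [Walk.getVert_zero, hHadj] at a1
      have b1 := p.getVert_mem_support 1
      grind
    · have a1 := p.adj_getVert_succ (i := p.length - 1) (by omega)
      rw [Nat.sub_add_cancel (by omega), Walk.getVert_length] at a1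
      have a2 := a1.symm
      rw [hHadj] at a2
      have b1 := p.getVert_mem_support (p.length - 1)
      grind
  have hMP : Mable G {x | x ∈ p.support} := ⟨n, by
    intro x hx
    refine ⟨?_, hn1 x, hn2 x⟩
    by_cases hxU : x ∈ U
    · exact hnU x hx hxU
    · exact (hint x hx hxU).1⟩
  have hMR : Mable G (Uᶜ \ {x | x ∈ p.support}) := ⟨m, by
    rintro x ⟨hx, hxp⟩
    obtain ⟨h1, h2, h3⟩ := hm x hx
    refine ⟨⟨h1, fun h => hxp ?_⟩, h2, h3⟩
    have := (hint (m x) h h1).2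
    rwa [h2] at this⟩
  have hodd : Odd p.length := by
    have e := hMP.even_ncard
    have : ({x | x ∈ p.support} : Set V).ncard = p.length + 1 := by
      have h1 : ({x | x ∈ p.support} : Set V) = (p.support.toFinset : Set V) := by
        ext; simp
      rw [h1, Set.ncard_coe_finset, List.toFinset_card_of_nodup hpath.support_nodup,
        Walk.length_support]
    rw [this] at e
    by_contra h
    rw [Nat.not_odd_iff_even] at h
    exact (Nat.not_even_iff_odd.2 h.add_one) e
  refine ⟨v, hv, w, hw, p.mapLe hHG, ?_, ?_, ?_, ?_, ?_⟩
  · simpa using hpath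
  · simpa using hodd
  · simpa using hU
  · simpa using hMP
  · simpa using hMR

/-- `S` is the vertex set of an odd cycle of `G`. -/
def OddCyc (G : SimpleGraph V) (S : Set V) : Prop :=
  ∃ v, ∃ C : G.Walk v v, C.IsCycle ∧ Odd C.length ∧ {x | x ∈ C.support} = S

theorem OddCyc.rotateTo {G : SimpleGraph V} {S : Set V} (h : OddCyc G S) {w : V} (hw : w ∈ S) :
    ∃ C : G.Walk w w, C.IsCycle ∧ Odd C.length ∧ {x | x ∈ C.support} = S := by
  classical
  obtain ⟨v, C, hC, ho, rfl⟩ := h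
  refine ⟨C.rotate w hw, hC.rotate hw, by simpa using ho, ?_⟩
  ext x; simp

/-- Lift a walk into a subgraph containing it. -/
theorem exists_lift {G : SimpleGraph V} {H : G.Subgraph} {u v : V} (p : G.Walk u v)
    (h : p.toSubgraph ≤ H) (hu : u ∈ H.verts) (hv : v ∈ H.verts) :
    ∃ q : H.coe.Walk ⟨u, hu⟩ ⟨v, hv⟩, q.map H.hom = p := by
  refine ⟨p.mapToSubgraph.map (Subgraph.inclusion h), ?_⟩
  exact (Walk.map_map _ _ _).trans p.map_mapToSubgraph_hom

theorem nice_of_pieces {G : SimpleGraph V} {v w : V} (C1 : G.Walk v v) (C2 : G.Walk w w)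
    (P : G.Walk v w) (h1 : C1.IsCycle) (h2 : C2.IsCycle) (o1 : Odd C1.length)
    (o2 : Odd C2.length) (hP : P.IsPath) (oP : Odd P.length)
    (d : ∀ x : V, x ∈ C1.support → x ∉ C2.support)
    (d1 : ∀ x : V, x ∈ P.support → x ∈ C1.support → x = v)
    (d2 : ∀ x : V, x ∈ P.support → x ∈ C2.support → x = w)
    (hM : Mable G {x | x ∉ C1.support ∧ x ∉ C2.support ∧ x ∉ P.support}) :
    HasNiceEvenSubdivT G := by
  let H : G.Subgraph := C1.toSubgraph ⊔ C2.toSubgraph ⊔ P.toSubgraph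
  have hH : ∀ x, x ∈ H.verts ↔ x ∈ C1.support ∨ x ∈ C2.support ∨ x ∈ P.support := by
    intro x
    simp [H, or_assoc]
  have hv : v ∈ H.verts := (hH v).2 (Or.inl C1.start_mem_support)
  have hw : w ∈ H.verts := (hH w).2 (Or.inr (Or.inl C2.start_mem_support))
  obtain ⟨D1, hD1⟩ := exists_lift (H := H) C1 (le_sup_left.trans le_sup_left) hv hv
  obtain ⟨D2, hD2⟩ := exists_lift (H := H) C2 (le_sup_right.trans le_sup_left) hw hw
  obtain ⟨Q, hQ⟩ := exists_lift (H := H) P le_sup_right hv hw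
  have hinj : Function.Injective H.hom := Subgraph.hom_injective
  have supp : ∀ {a b : H.verts} (q : H.coe.Walk a b) (x : H.verts),
      x ∈ q.support ↔ (x : V) ∈ (q.map H.hom).support := by
    intro a b q x
    rw [Walk.support_map]
    exact (List.mem_map_of_injective hinj (a := x)).symm
  have edg : ∀ {a b : H.verts} (q : H.coe.Walk a b) (e : Sym2 H.verts),
      e ∈ q.edges ↔ e.map Subtype.val ∈ (q.map H.hom).edges := by
    intro a b q e
    rw [Walk.edges_map]
    exact (List.mem_map_of_injective (Sym2.map.injective hinj) (a := e)).symm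
  refine ⟨H, ⟨⟨v, hv⟩, ⟨w, hw⟩, D1, D2, Q, ?_, ?_, ?_, ?_, ?_, ?_, ?_, ?_, ?_, ?_, ?_⟩, ?_⟩
  · rw [← Walk.isCycle_map_iff_of_injective hinj, hD1]; exact h1
  · rw [← Walk.isCycle_map_iff_of_injective hinj, hD2]; exact h2
  · rw [← D1.length_map H.hom, hD1]; exact o1
  · rw [← D2.length_map H.hom, hD2]; exact o2
  · rw [← Walk.isPath_map_iff_of_injective hinj, hQ]; exact hP
  · rw [← Q.length_map H.hom, hQ]; exact oP
  · intro x hx hx'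
    rw [supp] at hx hx'
    rw [hD1] at hx
    rw [hD2] at hx'
    exact d _ hx hx'
  · intro x hx hx'
    rw [supp] at hx hx'
    rw [hQ] at hx
    rw [hD1] at hx'
    exact Subtype.ext (d1 _ hx hx')
  · intro x hx hx'
    rw [supp] at hx hx'
    rw [hQ] at hx
    rw [hD2] at hx'
    exact Subtype.ext (d2 _ hx hx')
  · intro x
    rw [supp D1, supp D2, supp Q, hD1, hD2, hQ]
    exact (hH x).1 x.2
  · intro e
    rw [edg D1, edg D2, edg Q, hD1, hD2, hQ]
    induction e with
    | _ a b =>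
      simp only [Sym2.map_mk, mem_edgeSet, Subgraph.coe_adj, H, Subgraph.sup_adj, or_assoc]
      simp only [← Subgraph.mem_edgeSet, Walk.mem_edges_toSubgraph]
      exact Iff.rfl
  · apply Mable.hasPM_induce
    convert hM using 1
    ext x
    simp only [Set.mem_compl_iff, hH, Set.mem_ofPred_eq, not_or]

theorem nice_of_cover [Finite V] {G : SimpleGraph V} (hN : Mable G Set.univ) :
    ∀ (k : ℕ) (F : Finset (Set V)), F.card = k → F.Nonempty → (∀ S ∈ F, OddCyc G S) →
      (∀ S ∈ F, ∀ T ∈ F, S ≠ T → ∀ x ∈ S, x ∉ T) →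
      Mable G {x | ∃ S ∈ F, x ∈ S}ᶜ → HasNiceEvenSubdivT G := by
  classical
  intro k
  induction k using Nat.strong_induction_on with
  | _ k ih =>
  intro F hk hne hF hd hM
  obtain ⟨S, hSF⟩ := hne
  have hSo : Odd S.ncard := by
    obtain ⟨a, C, hC, ho, rfl⟩ := hF S hSF
    exact odd_ncard_cycle C hC ho
  obtain ⟨v, hv, w, ⟨⟨T, hTF, hwT⟩, hwS⟩, P, hP, oP, hPU, hMP, hMR⟩ :=
    exists_alt_path hN hM (S := S) (fun x hx => ⟨S, hSF, hx⟩) hSo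
  have hST : S ≠ T := by rintro rfl; exact hwS hwT
  obtain ⟨C1, c1, o1, rfl⟩ := (hF S hSF).rotateTo hv
  obtain ⟨C2, c2, o2, rfl⟩ := (hF T hTF).rotateTo hwT
  have hdd := hd _ hSF _ hTF hST
  have hvT := hdd v hv
  generalize hA : ({x | x ∈ C1.support} : Set V) = A at *
  generalize hB : ({x | x ∈ C2.support} : Set V) = B at *
  have hA' : ∀ x, x ∈ C1.support ↔ x ∈ A := by intro x; rw [← hA]; rfl
  have hB' : ∀ x, x ∈ C2.support ↔ x ∈ B := by intro x; rw [← hB]; rfl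
  have d1 : ∀ x ∈ P.support, x ∈ A → x = v := by
    intro x hx hxA
    rcases hPU x hx ⟨A, hSF, hxA⟩ with h | h
    · exact h
    · exact (hwS (h ▸ hxA)).elim
  have d2 : ∀ x ∈ P.support, x ∈ B → x = w := by
    intro x hx hxB
    rcases hPU x hx ⟨B, hTF, hxB⟩ with h | h
    · exact (hvT (h ▸ hxB)).elim
    · exact h
  let F' := (F.erase A).erase B
  have hF' : ∀ S, S ∈ F' ↔ S ≠ B ∧ S ≠ A ∧ S ∈ F := by intro S; simp [F']
  by_cases hE : F'.Nonempty
  · refine ih F'.card ?_ F' rfl hE ?_ ?_ ?_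
    · rw [← hk]
      exact (Finset.card_le_card (Finset.erase_subset _ _)).trans_lt
        (Finset.card_erase_lt_of_mem hSF)
    · intro S hS
      exact hF S ((hF' S).1 hS).2.2
    · intro S hS T hT
      exact hd S ((hF' S).1 hS).2.2 T ((hF' T).1 hT).2.2
    · have m1 := mable_odd_cycle C1 c1 o1
      have m2 := mable_odd_cycle C2 c2 o2
      rw [hA] at m1
      rw [hB] at m2
      have m3 := m1.union m2 (by
        rintro x ⟨hx, _⟩ ⟨hx', _⟩
        exact hdd x hx hx')
      have m4 := hMP.union hMR (by
        rintro x hx ⟨_, hx'⟩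
        exact hx' hx)
      have m5 := m3.union m4 (by
        rintro x (⟨hx, hx2⟩ | ⟨hx, hx2⟩) (h | ⟨h, _⟩)
        · exact hx2 (d1 x h hx)
        · exact h ⟨A, hSF, hx⟩
        · exact hx2 (d2 x h hx)
        · exact h ⟨B, hTF, hx⟩)
      convert m5 using 1
      have hvP := P.start_mem_support
      have hwP := P.end_mem_support
      ext x
      simp only [Set.mem_compl_iff, Set.mem_ofPred_eq, Set.mem_union, Set.mem_sdiff,
        Set.mem_singleton_iff, hF']
      constructor
      · intro hx
        by_cases hxP : x ∈ P.support
        · exact Or.inr (Or.inl hxP)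
        · by_cases hxA : x ∈ A
          · exact Or.inl (Or.inl ⟨hxA, fun h => hxP (h ▸ hvP)⟩)
          · by_cases hxB : x ∈ B
            · exact Or.inl (Or.inr ⟨hxB, fun h => hxP (h ▸ hwP)⟩)
            · refine Or.inr (Or.inr ⟨?_, hxP⟩)
              rintro ⟨S, hS, hxS⟩
              exact hx ⟨S, ⟨fun h => hxB (h ▸ hxS), fun h => hxA (h ▸ hxS), hS⟩, hxS⟩
      · rintro h ⟨S, ⟨hSB, hSA, hS⟩, hxS⟩
        have nA : x ∉ A := hd S hS A hSF hSA x hxS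
        have nB : x ∉ B := hd S hS B hTF hSB x hxS
        rcases h with (⟨h, _⟩ | ⟨h, _⟩) | (h | ⟨h, _⟩)
        · exact nA h
        · exact nB h
        · rcases hPU x h ⟨S, hS, hxS⟩ with h | h
          · exact nA (h ▸ hv)
          · exact nB (h ▸ hwT)
        · exact h ⟨S, hS, hxS⟩
  · refine nice_of_pieces C1 C2 P c1 c2 o1 o2 hP oP ?_ ?_ ?_ ?_
    · simpa only [hA', hB'] using hdd
    · simpa only [hA'] using d1
    · simpa only [hB'] using d2
    · convert hMR using 1
      ext x
      simp only [hA', hB', Set.mem_ofPred_eq, Set.mem_sdiff, Set.mem_compl_iff]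
      constructor
      · rintro ⟨nA, nB, nP⟩
        refine ⟨?_, nP⟩
        rintro ⟨S, hS, hxS⟩
        exact hE ⟨S, (hF' S).2 ⟨fun h => nB (h ▸ hxS), fun h => nA (h ▸ hxS), hS⟩⟩
      · rintro ⟨h, nP⟩
        exact ⟨fun h' => h ⟨A, hSF, h'⟩, fun h' => h ⟨B, hTF, h'⟩, nP⟩

theorem nice_of_oddCycleCover [Finite V] {G : SimpleGraph V} (hPM : HasPM G)
    (h : HasOddCycleCover G) : HasNiceEvenSubdivT G := by
  classical
  have hN : Mable G Set.univ := by
    obtain ⟨N, hN⟩ := hPM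
    have := Mable.of_isMatching hN.1
    rwa [Subgraph.isSpanning_iff.1 hN.2] at this
  obtain ⟨M, k, u, C, hk, hM, hC, hd, hCM, hcov⟩ := h
  let F : Finset (Set V) := Finset.univ.image fun i => {x | x ∈ (C i).support}
  refine nice_of_cover hN F.card F rfl ?_ ?_ ?_ ?_
  · have : Nonempty (Fin k) := ⟨⟨0, hk⟩⟩
    exact Finset.univ_nonempty.image _
  · intro S hS
    obtain ⟨i, _, rfl⟩ := Finset.mem_image.1 hS
    exact ⟨u i, C i, (hC i).1, (hC i).2, rfl⟩
  · intro S hS T hT hST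
    obtain ⟨i, _, rfl⟩ := Finset.mem_image.1 hS
    obtain ⟨j, _, rfl⟩ := Finset.mem_image.1 hT
    exact hd i j (by rintro rfl; exact hST rfl)
  · convert Mable.of_isMatching hM using 1
    ext x
    simp only [Set.mem_compl_iff, Set.mem_ofPred_eq]
    constructor
    · intro hx
      rcases hcov x with h | ⟨i, hi⟩
      · exact h
      · exact (hx ⟨_, Finset.mem_image_of_mem _ (Finset.mem_univ i), hi⟩).elim
    · rintro hx ⟨S, hS, hxS⟩
      obtain ⟨i, _, rfl⟩ := Finset.mem_image.1 hS
      exact hCM i x hxS hx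

theorem oddCycleCover_of_nice {G : SimpleGraph V} (h : HasNiceEvenSubdivT G) :
    HasOddCycleCover G := by
  classical
  obtain ⟨H, ⟨v, w, D1, D2, Q, c1, c2, o1, o2, hQ, oQ, d, d1, d2, hcov, -⟩, hPM⟩ := h
  have hinj : Function.Injective H.hom := Subgraph.hom_injective
  have supp : ∀ {a b : H.verts} (q : H.coe.Walk a b) (x : V),
      x ∈ (q.map H.hom).support ↔ ∃ hx : x ∈ H.verts, (⟨x, hx⟩ : H.verts) ∈ q.support := by
    intro a b q x
    rw [Walk.support_map, List.mem_map]
    constructor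
    · rintro ⟨y, hy, rfl⟩
      exact ⟨y.2, hy⟩
    · rintro ⟨hx, h⟩
      exact ⟨_, h, rfl⟩
  have mQ := mable_odd_path (Q.map H.hom)
    ((Walk.isPath_map_iff_of_injective hinj).2 hQ) ((Q.length_map H.hom).symm ▸ oQ)
  have mR := Mable.of_hasPM_induce hPM
  have m := mQ.union mR (by
    rintro x ⟨hx, _⟩ hx'
    obtain ⟨h1, _⟩ := (supp Q x).1 hx
    exact hx' h1)
  obtain ⟨M, hM, hMv⟩ := m.exists_isMatching
  have hdis1 : ∀ x ∈ (D1.map H.hom).support, x ∉ M.verts := by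
    intro x hx
    obtain ⟨h1, h2⟩ := (supp D1 x).1 hx
    rw [hMv]
    rintro (⟨h, h'⟩ | h)
    · obtain ⟨_, h3⟩ := (supp Q x).1 h
      exact h' (Or.inl (congrArg H.hom (d1 _ h3 h2)))
    · exact h h1
  have hdis2 : ∀ x ∈ (D2.map H.hom).support, x ∉ M.verts := by
    intro x hx
    obtain ⟨h1, h2⟩ := (supp D2 x).1 hx
    rw [hMv]
    rintro (⟨h, h'⟩ | h)
    · obtain ⟨_, h3⟩ := (supp Q x).1 h
      exact h' (Or.inr (congrArg H.hom (d2 _ h3 h2)))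
    · exact h h1
  have hdd : ∀ x ∈ (D1.map H.hom).support, x ∉ (D2.map H.hom).support := by
    intro x hx hx'
    obtain ⟨_, h1⟩ := (supp D1 x).1 hx
    obtain ⟨_, h2⟩ := (supp D2 x).1 hx'
    exact d _ h1 h2
  refine ⟨M, 2, ![H.hom v, H.hom w], fun i => match i with
    | 0 => D1.map H.hom
    | 1 => D2.map H.hom, by norm_num, hM, ?_, ?_, ?_, ?_⟩
  · intro i
    match i with
    | 0 => exact ⟨(Walk.isCycle_map_iff_of_injective hinj).2 c1,
        (D1.length_map H.hom).symm ▸ o1⟩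
    | 1 => exact ⟨(Walk.isCycle_map_iff_of_injective hinj).2 c2,
        (D2.length_map H.hom).symm ▸ o2⟩
  · intro i j hij
    match i, j with
    | 0, 0 => exact (hij rfl).elim
    | 1, 1 => exact (hij rfl).elim
    | 0, 1 => exact hdd
    | 1, 0 => exact fun x hx hx' => hdd x hx' hx
  · intro i
    match i with
    | 0 => exact hdis1
    | 1 => exact hdis2
  · intro x
    by_cases hx1 : x ∈ (D1.map H.hom).support
    · exact Or.inr ⟨0, hx1⟩
    by_cases hx2 : x ∈ (D2.map H.hom).support
    · exact Or.inr ⟨1, hx2⟩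
    left
    rw [hMv]
    by_cases hx : x ∈ H.verts
    · left
      have hs := hcov ⟨x, hx⟩
      have hxQ : x ∈ (Q.map H.hom).support := by
        rcases hs with h | h | h
        · exact (hx1 ((supp D1 x).2 ⟨hx, h⟩)).elim
        · exact (hx2 ((supp D2 x).2 ⟨hx, h⟩)).elim
        · exact (supp Q x).2 ⟨hx, h⟩
      refine ⟨hxQ, ?_⟩
      rintro (h | h)
      · subst h; exact hx1 (Walk.start_mem_support _)
      · rw [Set.mem_singleton_iff] at h; subst h; exact hx2 (Walk.start_mem_support _)
    · exact Or.inr hx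

/-- A graph with a perfect matching can be covered by independent edges together with a
positive number of vertex-disjoint odd cycles iff it contains an even subdivision of `T`
as a nice subgraph. -/
theorem oddCycleCover_iff_niceEvenSubdivT {V : Type*} [Fintype V] (G : SimpleGraph V)
    (hPM : HasPM G) : HasOddCycleCover G ↔ HasNiceEvenSubdivT G := by
  exact ⟨nice_of_oddCycleCover hPM, oddCycleCover_of_nice⟩
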